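/- arXiv:2205.07231 — 2 statements merged into one kernel-verified Lean document; each statement's English description precedes it below -/
import Mathlib

section
/- Let A > 0 be real, let B be a positive integer, let c, q > 0, and let γth ≥ 0. Then ∫_{γth}^∞ y^{A−1} e^{−c y} γ(B, q y) dy = (B−1)! · [ Γ(A, c γth)/c^A − Σ_{n=0}^{B−1} (q^n / n!) Γ(A+n, (c+q) γth) / (c+q)^{A+n} ]. -/
open MeasureTheory Real Set Filter

/-- The upper incomplete gamma function `Γ(s, x) = ∫_x^∞ t^(s-1) e^(-t) dt`. -/
noncomputable def upperGamma (s x : ℝ) : ℝ := ∫ t in Set.Ioi x, t ^ (s - 1) * Real.exp (-t)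

/-- The lower incomplete gamma function `γ(s, x) = ∫_0^x t^(s-1) e^(-t) dt`. -/
noncomputable def lowerGamma (s x : ℝ) : ℝ := ∫ t in (0:ℝ)..x, t ^ (s - 1) * Real.exp (-t)

/-- The derivative of a truncated exponential series is the series truncated one term earlier. -/
theorem hasDerivAt_sum_range_pow_div_factorial (m : ℕ) (t : ℝ) :
    HasDerivAt (fun x : ℝ => ∑ n ∈ Finset.range (m + 1), x ^ n / (n.factorial : ℝ))
      (∑ n ∈ Finset.range m, t ^ n / (n.factorial : ℝ)) t := by
  induction m with
  | zero => simpa using hasDerivAt_const t (1 : ℝ)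
  | succ m ih =>
    simp_rw [Finset.sum_range_succ _ (m + 1)]
    rw [Finset.sum_range_succ _ m]
    refine ih.add ?_
    refine ((hasDerivAt_pow (m + 1) t).div_const ((m + 1).factorial : ℝ)).congr_deriv ?_
    rw [Nat.factorial_succ]
    push_cast
    field_simp

/-- At a positive integer, the lower incomplete gamma function is elementary. -/
theorem lowerGamma_natCast_add_one (m : ℕ) (x : ℝ) :
    lowerGamma ((m + 1 : ℕ) : ℝ) x = (m.factorial : ℝ) *
      (1 - Real.exp (-x) * ∑ n ∈ Finset.range (m + 1), x ^ n / (n.factorial : ℝ)) := by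
  have hderiv : ∀ t : ℝ, HasDerivAt (fun t : ℝ => -(m.factorial : ℝ) *
      (Real.exp (-t) * ∑ n ∈ Finset.range (m + 1), t ^ n / (n.factorial : ℝ)))
      (t ^ m * Real.exp (-t)) t := by
    intro t
    refine ((((hasDerivAt_neg t).exp).mul (hasDerivAt_sum_range_pow_div_factorial m
      t)).const_mul (-(m.factorial : ℝ))).congr_deriv ?_
    rw [Finset.sum_range_succ]
    field_simp
    ring
  have hpow (t : ℝ) : t ^ (((m + 1 : ℕ) : ℝ) - 1) = t ^ m := by
    rw [Nat.cast_add_one, add_sub_cancel_right, Real.rpow_natCast]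
  have hzero : ∑ n ∈ Finset.range (m + 1), (0 : ℝ) ^ n / (n.factorial : ℝ) = 1 := by
    simp [Finset.sum_range_succ']
  simp_rw [lowerGamma, hpow]
  rw [intervalIntegral.integral_eq_sub_of_hasDerivAt (fun t _ => hderiv t)
    (Continuous.intervalIntegrable (by fun_prop) _ _), hzero]
  simp
  ring

theorem integrableOn_rpow_mul_exp_neg_mul_Ioi {s c g : ℝ} (hs : 0 < s) (hc : 0 < c)
    (hg : 0 ≤ g) :
    IntegrableOn (fun y : ℝ => y ^ (s - 1) * Real.exp (-(c * y))) (Ioi g) := by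
  have h := integrableOn_rpow_mul_exp_neg_mul_rpow (p := 1) (s := s - 1) (by linarith) one_pos hc
  simp only [Real.rpow_one, neg_mul] at h
  exact h.mono_set (Ioi_subset_Ioi hg)

theorem integral_rpow_mul_exp_neg_mul_Ioi_eq_upperGamma {s c g : ℝ} (hc : 0 < c) (hg : 0 ≤ g) :
    ∫ y in Ioi g, y ^ (s - 1) * Real.exp (-(c * y)) = upperGamma s (c * g) / c ^ s := by
  have h := integral_comp_mul_left_Ioi (fun t : ℝ => t ^ (s - 1) * Real.exp (-t)) g hc
  rw [smul_eq_mul] at h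
  have h' : ∫ y in Ioi g, (c * y) ^ (s - 1) * Real.exp (-(c * y)) =
      c ^ (s - 1) * ∫ y in Ioi g, y ^ (s - 1) * Real.exp (-(c * y)) := by
    rw [← integral_const_mul]
    refine setIntegral_congr_fun measurableSet_Ioi fun y hy => ?_
    rw [Real.mul_rpow hc.le (hg.trans (le_of_lt hy)), mul_assoc]
  rw [h', Real.rpow_sub_one hc.ne'] at h
  have hcs := (Real.rpow_pos_of_pos hc s).ne'
  rw [upperGamma]
  field_simp at h ⊢
  linarith

theorem integral_pow_exp_mul_lowerGamma
    (A : ℝ) (hA : 0 < A) (B : ℕ) (hB : 0 < B)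
    (c q : ℝ) (hc : 0 < c) (hq : 0 < q)
    (γth : ℝ) (hγth : 0 ≤ γth) :
    ∫ y in Set.Ioi γth, y ^ (A - 1) * Real.exp (-(c * y)) * lowerGamma (B : ℝ) (q * y)
      = (Nat.factorial (B - 1) : ℝ)
          * (upperGamma A (c * γth) / c ^ A
            - ∑ n ∈ Finset.range B,
                (q ^ n / (Nat.factorial n : ℝ))
                  * upperGamma (A + n) ((c + q) * γth) / (c + q) ^ (A + (n : ℝ))) := by
  obtain ⟨m, rfl⟩ : ∃ m, B = m + 1 := ⟨B - 1, by lia⟩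
  have hexpand : ∀ y ∈ Ioi γth,
      y ^ (A - 1) * Real.exp (-(c * y)) * lowerGamma ((m + 1 : ℕ) : ℝ) (q * y) =
        (m.factorial : ℝ) * (y ^ (A - 1) * Real.exp (-(c * y)) -
          ∑ n ∈ Finset.range (m + 1), q ^ n / (n.factorial : ℝ) *
            (y ^ (A + n - 1) * Real.exp (-((c + q) * y)))) := by
    intro y hy
    have hy0 : 0 < y := hγth.trans_lt hy
    have hexp : Real.exp (-((c + q) * y)) = Real.exp (-(c * y)) * Real.exp (-(q * y)) := by
      rw [← Real.exp_add]
      ring_nf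
    have hpow (n : ℕ) : y ^ (A + n - 1) = y ^ (A - 1) * y ^ n := by
      rw [add_sub_right_comm, Real.rpow_add_natCast hy0.ne']
    have hsum : ∑ n ∈ Finset.range (m + 1), q ^ n / (n.factorial : ℝ) *
        (y ^ (A + n - 1) * Real.exp (-((c + q) * y))) =
        y ^ (A - 1) * Real.exp (-(c * y)) * (Real.exp (-(q * y)) *
          ∑ n ∈ Finset.range (m + 1), (q * y) ^ n / (n.factorial : ℝ)) := by
      simp_rw [Finset.mul_sum, hexp, hpow, mul_pow]
      exact Finset.sum_congr rfl fun n _ => by ring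
    rw [lowerGamma_natCast_add_one, hsum]
    ring
  have hterm : ∀ n ∈ Finset.range (m + 1), IntegrableOn (fun y : ℝ => q ^ n / (n.factorial : ℝ) *
      (y ^ (A + n - 1) * Real.exp (-((c + q) * y)))) (Ioi γth) := fun n _ =>
    (integrableOn_rpow_mul_exp_neg_mul_Ioi (by positivity) (by positivity) hγth).const_mul _
  rw [setIntegral_congr_fun measurableSet_Ioi hexpand, integral_const_mul,
    integral_sub (integrableOn_rpow_mul_exp_neg_mul_Ioi hA hc hγth) (integrable_finsetSum _ hterm),
    integral_finsetSum _ hterm, integral_rpow_mul_exp_neg_mul_Ioi_eq_upperGamma hc hγth]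
  simp_rw [integral_const_mul,
    integral_rpow_mul_exp_neg_mul_Ioi_eq_upperGamma (add_pos hc hq) hγth, mul_div_assoc,
    Nat.add_sub_cancel]
end

section
/- Let m_SR, m_RD, m_SE1, m_RE2 and N_R, N_D, N_E1, N_E2 be positive integers, let δ_SE1, δ_RE2 > 0, and let γth > 0. For δ > 0, let X1, X2, X3, X4 be independent real random variables with Gamma distributions: X1 of shape m_SR·N_R and rate m_SR/δ, X2 of shape m_SE1·N_E1 and rate m_SE1/δ_SE1, X3 of shape m_RD·N_D and rate m_RD/δ, and X4 of shape m_RE2·N_E2 and rate m_RE2/δ_RE2, and set P_int(δ) = 1 − P(X1 > γth and X1 > X2 and X1 > X4 and X3 > X4). Then δ^{G_d} · P_int(δ) → G_c as δ → +∞, where G_d = min(m_SR·N_R, m_RD·N_D) and G_c is given by: G_c = R if m_SR·N_R > m_RD·N_D; G_c = T1 + T2 − T3 if m_SR·N_R < m_RD·N_D; G_c = R + T1 + T2 − T3 if m_SR·N_R = m_RD·N_D. Here R = (m_RD δ_RE2 / m_RE2)^{m_RD N_D} · (m_RE2 N_E2 + m_RD N_D − 1)! / ( (m_RE2 N_E2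 − 1)! (m_RD N_D)! ); T1 = ( (m_SR γth)^{m_SR N_R} / (m_SR N_R)! ) · ( γ(m_RE2 N_E2, (m_RE2/δ_RE2) γth) / (m_RE2 N_E2 − 1)! ) · ( γ(m_SE1 N_E1, (m_SE1/δ_SE1) γth) / (m_SE1 N_E1 − 1)! ); T2 = m_SR^{m_SR N_R} (F_{SE1} + F_{RE2}) / (m_SR N_R)! with F_{xy} = (δ_xy/m_xy)^{m_SR N_R} Γ(m_xy N_y + m_SR N_R, (m_xy/δ_xy) γth) / (m_xy N_y − 1)! for (x,y) ∈ {(S,E1),(R,E2)}; and T3 = m_SR^{m_SR N_R} (G_{S,E1,R,E2} + G_{R,E2,S,E1}) / (m_SR N_R)! with G_{x,y,z,t} = ( (m_xy/δ_xy)^{m_xy N_y} / (m_xy N_y − 1)! ) · Σ_{n=0}^{m_zt N_t − 1} ( (m_zt/δ_zt)^n / n! ) · Γ(m_xy N_y + m_SR N_R + n, (m_xy/δ_xy + m_zt/δ_zt) γth) / (m_xy/δ_xy + m_zt/δ_zt)^{n + m_xy N_y + m_SR N_R}. -/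
open MeasureTheory ProbabilityTheory Real Set Filter Topology

section GammaLaw

variable {k : ℕ} {r : ℝ}

/-- The density of the Gamma law of integer shape `k` and rate `r` on the nonnegative reals. -/
noncomputable def erlangPDF (k : ℕ) (r x : ℝ) : ℝ :=
  r ^ k / ((k - 1).factorial : ℝ) * x ^ (k - 1) * Real.exp (-(r * x))

lemma continuous_erlangPDF (k : ℕ) (r : ℝ) : Continuous (erlangPDF k r) := by
  unfold erlangPDF; fun_prop

lemma erlangPDF_nonneg (hr : 0 < r) {x : ℝ} (hx : 0 ≤ x) : 0 ≤ erlangPDF k r x := by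
  unfold erlangPDF; positivity

lemma gammaPDFReal_natCast (hk : 0 < k) {x : ℝ} (hx : 0 ≤ x) :
    gammaPDFReal k r x = erlangPDF k r x := by
  obtain ⟨j, rfl⟩ := Nat.exists_eq_succ_of_ne_zero hk.ne'
  have hΓ : Real.Gamma ((j.succ : ℕ) : ℝ) = (j.factorial : ℝ) := by
    rw [Nat.cast_succ]; exact Real.Gamma_nat_eq_factorial j
  have hp : x ^ (((j.succ : ℕ) : ℝ) - 1) = x ^ j := by
    rw [Nat.cast_succ, add_sub_cancel_right, Real.rpow_natCast]
  rw [gammaPDFReal, if_pos hx, hΓ, hp, Real.rpow_natCast]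
  rfl

lemma measurable_gammaPDF (a r : ℝ) : Measurable (gammaPDF a r) :=
  (measurable_gammaPDFReal a r).ennreal_ofReal

lemma setIntegral_gammaMeasure (hk : 0 < k) (hr : 0 < r) {s : Set ℝ} (hs : MeasurableSet s)
    (hs0 : s ⊆ Ici 0) (g : ℝ → ℝ) :
    ∫ x in s, g x ∂gammaMeasure k r = ∫ x in s, erlangPDF k r x * g x := by
  rw [gammaMeasure, setIntegral_withDensity_eq_setIntegral_toReal_smul (measurable_gammaPDF _ _)
    (ae_of_all _ fun x => ENNReal.ofReal_lt_top) g hs]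
  refine setIntegral_congr_fun hs fun x hx => ?_
  simp only [smul_eq_mul, gammaPDF]
  rw [gammaPDFReal_natCast hk (hs0 hx), ENNReal.toReal_ofReal (erlangPDF_nonneg hr (hs0 hx))]

lemma ae_pos_gammaMeasure (a r : ℝ) : ∀ᵐ x ∂gammaMeasure a r, 0 < x := by
  rw [gammaMeasure, ae_withDensity_iff (measurable_gammaPDF _ _)]
  filter_upwards [Measure.ae_ne volume (0 : ℝ)] with x hx h
  by_contra! hneg
  exact h (gammaPDF_of_neg (lt_of_le_of_ne hneg hx))

lemma gammaMeasure_restrict_Ioi (a r : ℝ) :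
    (gammaMeasure a r).restrict (Ioi 0) = gammaMeasure a r :=
  Measure.restrict_eq_self_of_ae_mem (ae_pos_gammaMeasure a r)

instance nullSingletonClass_gammaMeasure (a r : ℝ) : NullSingletonClass (gammaMeasure a r) := by
  unfold gammaMeasure; infer_instance

lemma isProbabilityMeasure_gammaMeasure_natCast (hk : 0 < k) (hr : 0 < r) :
    IsProbabilityMeasure (gammaMeasure k r) :=
  isProbabilityMeasure_gammaMeasure (Nat.cast_pos.mpr hk) hr

lemma integrableOn_pow_mul_exp_neg_mul (n : ℕ) (hr : 0 < r) :
    IntegrableOn (fun t : ℝ => t ^ n * Real.exp (-(r * t))) (Ioi 0) := by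
  have h := integrableOn_rpow_mul_exp_neg_mul_rpow (p := 1) (s := n) (b := r)
    (by have := Nat.cast_nonneg (α := ℝ) n; linarith) one_pos hr
  simpa [Real.rpow_natCast, neg_mul] using h

lemma integral_pow_mul_exp_neg_mul (n : ℕ) (hr : 0 < r) :
    ∫ t in Ioi (0 : ℝ), t ^ n * Real.exp (-(r * t)) = (n.factorial : ℝ) / r ^ (n + 1) := by
  have h := Real.integral_rpow_mul_exp_neg_mul_Ioi (a := (n : ℝ) + 1) (r := r) (by positivity) hr
  rw [Real.Gamma_nat_eq_factorial, add_sub_cancel_right] at h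
  simp only [Real.rpow_natCast] at h
  rw [h, ← Nat.cast_succ, Real.rpow_natCast, one_div, inv_pow]
  field_simp

lemma integrable_pow_gammaMeasure (hk : 0 < k) (hr : 0 < r) (n : ℕ) :
    Integrable (fun x => x ^ n) (gammaMeasure k r) := by
  rw [← gammaMeasure_restrict_Ioi, gammaMeasure, restrict_withDensity measurableSet_Ioi,
    integrable_withDensity_iff (measurable_gammaPDF _ _)
      (ae_of_all _ fun x => ENNReal.ofReal_lt_top)]
  have h := (integrableOn_pow_mul_exp_neg_mul (n + (k - 1)) hr).const_mul
    (r ^ k / ((k - 1).factorial : ℝ))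
  refine IntegrableOn.congr_fun h (fun x (hx : 0 < x) => ?_) measurableSet_Ioi
  simp only [gammaPDF]
  rw [gammaPDFReal_natCast hk hx.le, ENNReal.toReal_ofReal (erlangPDF_nonneg hr hx.le), erlangPDF]
  ring

lemma integral_pow_gammaMeasure (hk : 0 < k) (hr : 0 < r) (n : ℕ) :
    ∫ x, x ^ n ∂gammaMeasure k r
      = ((k + n - 1).factorial : ℝ) / (((k - 1).factorial : ℝ) * r ^ n) := by
  rw [← gammaMeasure_restrict_Ioi,
    setIntegral_gammaMeasure hk hr measurableSet_Ioi Ioi_subset_Ici_self]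
  have : ∀ x : ℝ, erlangPDF k r x * x ^ n = r ^ k / ((k - 1).factorial : ℝ) *
      (x ^ (k + n - 1) * Real.exp (-(r * x))) := fun x => by
    rw [erlangPDF, show k + n - 1 = (k - 1) + n by omega, pow_add]; ring
  simp_rw [this]
  rw [integral_const_mul, integral_pow_mul_exp_neg_mul _ hr, show k + n - 1 + 1 = k + n by omega,
    pow_add]
  field_simp

lemma gammaMeasure_real_Iic (hk : 0 < k) (hr : 0 < r) {x : ℝ} (hx : 0 ≤ x) :
    (gammaMeasure k r).real (Iic x) = ∫ t in (0 : ℝ)..x, erlangPDF k r t := by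
  have h : (gammaMeasure k r).real (Iic x) = (gammaMeasure k r).real (Ioc 0 x) := by
    refine measureReal_congr ?_
    filter_upwards [ae_pos_gammaMeasure k r] with t ht
    exact propext ⟨fun h => ⟨ht, h⟩, fun h => h.2⟩
  rw [h, ← setIntegral_one_eq_measureReal, setIntegral_gammaMeasure hk hr measurableSet_Ioc
    (fun t ht => ht.1.le), intervalIntegral.integral_of_le hx]
  simp

lemma hasDerivAt_erlangCDF (hk : 0 < k) (r x : ℝ) :
    HasDerivAt (fun x => 1 - Real.exp (-(r * x)) *
      ∑ n ∈ Finset.range k, (r * x) ^ n / (n.factorial : ℝ)) (erlangPDF k r x) x := by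
  have hE : HasDerivAt (fun x => Real.exp (-(r * x))) (Real.exp (-(r * x)) * (-r)) x := by
    simpa using ((hasDerivAt_id x).const_mul r).neg.exp
  induction k, hk using Nat.le_induction with
  | base =>
    refine ((hE.const_sub 1).congr_deriv ?_).congr_of_eventuallyEq
      (Eventually.of_forall fun y => ?_)
    · simp only [erlangPDF, Nat.succ_eq_add_one, zero_add, Nat.sub_self, Nat.factorial_zero]
      norm_num
      ring
    · simp
  | succ j hj ih =>
    have hT : HasDerivAt (fun x => (r * x) ^ j / (j.factorial : ℝ))
        ((j : ℝ) * (r * x) ^ (j - 1) * r / (j.factorial : ℝ)) x := by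
      simpa using (((hasDerivAt_id x).const_mul r).pow j).div_const (j.factorial : ℝ)
    have h := ih.sub (hE.mul hT)
    refine (h.congr_deriv ?_).congr_of_eventuallyEq (Eventually.of_forall fun y => ?_)
    · obtain ⟨i, rfl⟩ := Nat.exists_eq_succ_of_ne_zero (Nat.pos_iff_ne_zero.mp hj)
      simp only [erlangPDF, Nat.succ_eq_add_one, Nat.add_sub_cancel, Nat.factorial_succ]
      push_cast
      field_simp
      ring
    · simp only [Finset.sum_range_succ, Pi.sub_apply, Pi.mul_apply]
      ring

lemma gammaMeasure_real_Iic_eq_erlang (hk : 0 < k) (hr : 0 < r) {x : ℝ} (hx : 0 ≤ x) :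
    (gammaMeasure k r).real (Iic x) = 1 - Real.exp (-(r * x)) *
      ∑ n ∈ Finset.range k, (r * x) ^ n / (n.factorial : ℝ) := by
  rw [gammaMeasure_real_Iic hk hr hx, intervalIntegral.integral_eq_sub_of_hasDerivAt
    (fun t _ => hasDerivAt_erlangCDF hk r t)
    ((continuous_erlangPDF k r).intervalIntegrable _ _)]
  have h0 : ∑ n ∈ Finset.range k, (0 : ℝ) ^ n / (n.factorial : ℝ) = 1 := by
    rw [Finset.sum_eq_single 0 (fun n _ hn => by simp [hn]) (by simp [hk.ne'])]
    simp
  simp [h0]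

lemma integral_const_mul_pow_eq (hk : 0 < k) (r x : ℝ) :
    ∫ t in (0 : ℝ)..x, r ^ k / ((k - 1).factorial : ℝ) * t ^ (k - 1)
      = (r * x) ^ k / (k.factorial : ℝ) := by
  obtain ⟨j, rfl⟩ := Nat.exists_eq_succ_of_ne_zero hk.ne'
  rw [intervalIntegral.integral_const_mul, integral_pow]
  simp only [Nat.succ_eq_add_one, Nat.add_sub_cancel, Nat.factorial_succ]
  push_cast
  field_simp
  simp
  ring

lemma gammaMeasure_real_Iic_le (hk : 0 < k) (hr : 0 < r) {x : ℝ} (hx : 0 ≤ x) :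
    (gammaMeasure k r).real (Iic x) ≤ (r * x) ^ k / (k.factorial : ℝ) := by
  rw [gammaMeasure_real_Iic hk hr hx, ← integral_const_mul_pow_eq hk]
  refine intervalIntegral.integral_mono_on hx ((continuous_erlangPDF k r).intervalIntegrable _ _)
    (Continuous.intervalIntegrable (by fun_prop) _ _) fun t ht => ?_
  have ht0 : 0 ≤ t := ht.1
  exact mul_le_of_le_one_right (by positivity)
    (Real.exp_le_one_iff.mpr (neg_nonpos.mpr (by positivity)))

lemma le_gammaMeasure_real_Iic (hk : 0 < k) (hr : 0 < r) {x : ℝ} (hx : 0 ≤ x) :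
    (r * x) ^ k / (k.factorial : ℝ) * Real.exp (-(r * x)) ≤ (gammaMeasure k r).real (Iic x) := by
  rw [gammaMeasure_real_Iic hk hr hx, ← integral_const_mul_pow_eq hk,
    ← intervalIntegral.integral_mul_const]
  refine intervalIntegral.integral_mono_on hx
    (Continuous.intervalIntegrable (by fun_prop) _ _)
    ((continuous_erlangPDF k r).intervalIntegrable _ _) fun t ht => ?_
  have ht0 : 0 ≤ t := ht.1
  refine mul_le_mul_of_nonneg_left ?_ (by positivity)
  gcongr
  exact ht.2

lemma gammaMeasure_real_Iic_eq_lowerGamma (hk : 0 < k) (hr : 0 < r) {x : ℝ} (hx : 0 ≤ x) :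
    (gammaMeasure k r).real (Iic x)
      = lowerGamma (k : ℝ) (r * x) / ((k - 1).factorial : ℝ) := by
  have hp : ((k : ℝ) - 1) = ((k - 1 : ℕ) : ℝ) := by rw [Nat.cast_sub hk, Nat.cast_one]
  have h := intervalIntegral.mul_integral_comp_mul_left (a := 0) (b := x)
    (f := fun t : ℝ => t ^ (k - 1) * Real.exp (-t)) r
  rw [mul_zero] at h
  rw [gammaMeasure_real_Iic hk hr hx, lowerGamma, hp]
  simp only [Real.rpow_natCast]
  rw [← h, ← intervalIntegral.integral_const_mul, ← intervalIntegral.integral_div]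
  congr 1 with t
  obtain ⟨j, rfl⟩ := Nat.exists_eq_succ_of_ne_zero hk.ne'
  simp only [erlangPDF, Nat.succ_eq_add_one, Nat.add_sub_cancel, mul_pow]
  ring

lemma integral_Ioi_pow_mul_exp_neg_mul (n : ℕ) (hr : 0 < r) (c : ℝ) :
    ∫ t in Ioi c, t ^ n * Real.exp (-(r * t)) = upperGamma ((n : ℝ) + 1) (r * c) / r ^ (n + 1) := by
  have h := integral_comp_mul_left_Ioi (fun t : ℝ => t ^ n * Real.exp (-t)) c hr
  rw [upperGamma, add_sub_cancel_right]
  simp only [Real.rpow_natCast]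
  simp only [smul_eq_mul, mul_pow, mul_assoc] at h
  rw [integral_const_mul] at h
  have hr' : r ^ (n + 1) ≠ 0 := by positivity
  rw [eq_div_iff hr', pow_succ, mul_comm, mul_right_comm, h]
  field_simp

end GammaLaw

section ProductFormula

/-- The probability of secure transmission, conditioned on the two wiretap SNRs. -/
lemma pi_real_secure_eq_integral (μ : Fin 4 → Measure ℝ) [∀ i, IsProbabilityMeasure (μ i)]
    (c : ℝ) :
    (Measure.pi μ).real {x | x 0 > c ∧ x 0 > x 1 ∧ x 0 > x 3 ∧ x 2 > x 3}
      = ∫ y, (1 - (μ 0).real (Iic (max c (max y.1 y.2)))) * (1 - (μ 2).real (Iic y.2))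
          ∂(μ 1).prod (μ 3) := by
  have hind : iIndepFun (fun (i : Fin 4) (ω : Fin 4 → ℝ) => ω i) (Measure.pi μ) :=
    iIndepFun_pi (X := fun _ => id) (fun _ => aemeasurable_id)
  have hmap : ∀ i, (Measure.pi μ).map (fun ω => ω i) = μ i :=
    fun i => (measurePreserving_eval μ i).map_eq
  have hpair : ∀ i j, i ≠ j →
      (Measure.pi μ).map (fun ω => (ω i, ω j)) = (μ i).prod (μ j) := fun i j hij => by
    rw [(hind.indepFun hij).map_prod_eq_prod_map_map (measurable_pi_apply i).aemeasurable
      (measurable_pi_apply j).aemeasurable, hmap, hmap]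
  have hquad : (Measure.pi μ).map (fun ω => ((ω 0, ω 2), (ω 1, ω 3)))
      = ((μ 0).prod (μ 2)).prod ((μ 1).prod (μ 3)) := by
    rw [(hind.indepFun_prodMk_prodMk (fun i => measurable_pi_apply i) 0 2 1 3
      (by decide) (by decide) (by decide) (by decide)).map_prod_eq_prod_map_map
      (by fun_prop) (by fun_prop), hpair 0 2 (by decide), hpair 1 3 (by decide)]
  set S : Set ((ℝ × ℝ) × (ℝ × ℝ)) :=
    {p | c < p.1.1 ∧ p.2.1 < p.1.1 ∧ p.2.2 < p.1.1 ∧ p.2.2 < p.1.2} with hSdef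
  have hS : MeasurableSet S := by measurability
  have hfib : ∀ y : ℝ × ℝ, (fun x => (x, y)) ⁻¹' S = Ioi (max c (max y.1 y.2)) ×ˢ Ioi y.2 := by
    rintro ⟨y, z⟩
    ext ⟨u, v⟩
    simp [hSdef, and_assoc]
  have hIoi : ∀ i t, (μ i).real (Ioi t) = 1 - (μ i).real (Iic t) := fun i t => by
    rw [← compl_Iic, probReal_compl_eq_one_sub measurableSet_Iic]
  have hpre : {x : Fin 4 → ℝ | x 0 > c ∧ x 0 > x 1 ∧ x 0 > x 3 ∧ x 2 > x 3}
      = (fun ω : Fin 4 → ℝ => ((ω 0, ω 2), (ω 1, ω 3))) ⁻¹' S := rfl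
  rw [hpre, measureReal_def, ← Measure.map_apply (by fun_prop) hS, hquad,
    Measure.prod_apply_symm hS, ← integral_toReal (measurable_measure_prodMk_right hS).aemeasurable
      (ae_of_all _ fun y => measure_lt_top _ _)]
  refine integral_congr_ae (ae_of_all _ fun y => ?_)
  simp only [hfib, Measure.prod_prod, ENNReal.toReal_mul]
  rw [← hIoi, ← hIoi]
  rfl

end ProductFormula

section MaxMoment

variable {p q : ℕ} {α β : ℝ}

lemma integrable_max_pow {μ ν : Measure ℝ} [IsProbabilityMeasure μ] [IsProbabilityMeasure ν]
    {n : ℕ} (hμ : Integrable (fun x => x ^ n) μ) (hν : Integrable (fun x => x ^ n) ν)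
    (hμ0 : ∀ᵐ x ∂μ, 0 < x) (hν0 : ∀ᵐ x ∂ν, 0 < x) {c : ℝ} (hc : 0 < c) :
    Integrable (fun y : ℝ × ℝ => max c (max y.1 y.2) ^ n) (μ.prod ν) := by
  have h1 := hμ.comp_fst ν
  have h2 := hν.comp_snd μ
  refine ((integrable_const (c ^ n)).add (h1.add h2)).mono'
    (Measurable.aestronglyMeasurable (by fun_prop)) ?_
  filter_upwards [Measure.quasiMeasurePreserving_fst.ae hμ0,
    Measure.quasiMeasurePreserving_snd.ae hν0] with y hy1 hy2
  have e1 : 0 ≤ y.1 ^ n := by positivity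
  have e2 : 0 ≤ y.2 ^ n := by positivity
  have e3 : 0 ≤ c ^ n := by positivity
  rw [Real.norm_of_nonneg (by positivity)]
  simp only [Pi.add_apply]
  rcases max_choice c (max y.1 y.2) with h | h
  · rw [h]; linarith
  · rw [h]
    rcases max_choice y.1 y.2 with h | h <;> rw [h] <;> linarith

/-- Splitting `E[max(c, Y, Z)^n]` according to which of the three terms is the maximum. -/
lemma integral_max_pow {μ ν : Measure ℝ} [IsProbabilityMeasure μ] [IsProbabilityMeasure ν]
    [NullSingletonClass μ]
    {n : ℕ} (hμ : Integrable (fun x => x ^ n) μ) (hν : Integrable (fun x => x ^ n) ν)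
    (c : ℝ) :
    ∫ y, max c (max y.1 y.2) ^ n ∂μ.prod ν
      = c ^ n * (μ.real (Iic c) * ν.real (Iic c))
        + (∫ x in Ioi c, x ^ n * ν.real (Iic x) ∂μ) + ∫ x in Ioi c, x ^ n * μ.real (Iic x) ∂ν := by
  set A : Set (ℝ × ℝ) := Iic c ×ˢ Iic c with hA
  set B : Set (ℝ × ℝ) := {y | c < y.1 ∧ y.2 ≤ y.1} with hB
  set C : Set (ℝ × ℝ) := {y | c < y.2 ∧ y.1 < y.2} with hC
  have mA : MeasurableSet A := measurableSet_Iic.prod measurableSet_Iic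
  have mB : MeasurableSet B := by measurability
  have mC : MeasurableSet C := by measurability
  have h1 := hμ.comp_fst ν
  have h2 := hν.comp_snd μ
  have key : ∀ y : ℝ × ℝ, max c (max y.1 y.2) ^ n = A.indicator (fun _ => c ^ n) y
      + B.indicator (fun y => y.1 ^ n) y + C.indicator (fun y => y.2 ^ n) y := by
    rintro ⟨y, z⟩
    simp only [Set.indicator, hA, hB, hC, Set.mem_prod, Set.mem_Iic, Set.mem_ofPred_eq]
    by_cases hy : c < y <;> by_cases hz : c < z <;> by_cases hyz : y < z
    · rw [max_eq_right hyz.le, max_eq_right hz.le]; simp [hy.not_ge, hz, hyz]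
    · rw [max_eq_left (not_lt.mp hyz), max_eq_right hy.le]; simp [hy, hyz, hy.not_ge, not_lt.mp hyz]
    · exact absurd (hy.trans hyz) hz
    · rw [max_eq_left (not_lt.mp hyz), max_eq_right hy.le]; simp [hy, hyz, hy.not_ge, not_lt.mp hyz]
    · rw [max_eq_right hyz.le, max_eq_right hz.le]; simp [hy, hz.not_ge, hz, hyz]
    · exact absurd (hz.trans_le (not_lt.mp hyz)) hy
    · rw [max_eq_left (max_le (not_lt.mp hy) (not_lt.mp hz))]
      simp [not_lt.mp hy, not_lt.mp hz, hy, hz]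
    · rw [max_eq_left (max_le (not_lt.mp hy) (not_lt.mp hz))]
      simp [not_lt.mp hy, not_lt.mp hz, hy, hz]
  have iA : Integrable (A.indicator fun _ : ℝ × ℝ => c ^ n) (μ.prod ν) :=
    (integrable_const _).indicator mA
  have iB : Integrable (B.indicator fun y : ℝ × ℝ => y.1 ^ n) (μ.prod ν) := h1.indicator mB
  have iC : Integrable (C.indicator fun y : ℝ × ℝ => y.2 ^ n) (μ.prod ν) := h2.indicator mC
  simp_rw [key]
  rw [integral_add (by exact iA.add iB) iC, integral_add iA iB]
  congr 1
  · congr 1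
    · rw [integral_indicator mA, setIntegral_const, hA, measureReal_prod_prod, smul_eq_mul,
        mul_comm]
    · rw [integral_prod _ iB, ← integral_indicator measurableSet_Ioi]
      refine integral_congr_ae (ae_of_all _ fun y => ?_)
      by_cases hy : c < y
      · have : ∀ z : ℝ, B.indicator (fun y => y.1 ^ n) (y, z)
            = (Iic y).indicator (fun _ => y ^ n) z := fun z => by
          simp [Set.indicator, hB, hy]
        simp only [this]
        rw [integral_indicator measurableSet_Iic, setIntegral_const, smul_eq_mul,
          Set.indicator_of_mem (show y ∈ Ioi c from hy), mul_comm]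
      · have : ∀ z : ℝ, B.indicator (fun y => y.1 ^ n) (y, z) = 0 := fun z => by
          simp [Set.indicator, hB, hy]
        simp only [this]
        rw [integral_zero, Set.indicator_of_notMem (show y ∉ Ioi c from hy)]
  · rw [integral_prod_symm _ iC, ← integral_indicator measurableSet_Ioi]
    refine integral_congr_ae (ae_of_all _ fun z => ?_)
    by_cases hz : c < z
    · have : ∀ y : ℝ, C.indicator (fun y => y.2 ^ n) (y, z)
          = (Iio z).indicator (fun _ => z ^ n) y := fun y => by
        simp [Set.indicator, hC, hz]
      simp only [this]
      rw [integral_indicator measurableSet_Iio, setIntegral_const, smul_eq_mul,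
        measureReal_congr Iio_ae_eq_Iic, Set.indicator_of_mem (show z ∈ Ioi c from hz), mul_comm]
    · have : ∀ y : ℝ, C.indicator (fun y => y.2 ^ n) (y, z) = 0 := fun y => by
        simp [Set.indicator, hC, hz]
      simp only [this]
      rw [integral_zero, Set.indicator_of_notMem (show z ∉ Ioi c from hz)]

lemma setIntegral_pow_mul_gammaMeasure_real_Iic (hp : 0 < p) (hq : 0 < q) (hα : 0 < α)
    (hβ : 0 < β) (a : ℕ) {c : ℝ} (hc : 0 < c) :
    ∫ x in Ioi c, x ^ a * (gammaMeasure q β).real (Iic x) ∂gammaMeasure p α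
      = (1 / α) ^ a * upperGamma ((p + a : ℕ) : ℝ) (α * c) / ((p - 1).factorial : ℝ)
        - α ^ p / ((p - 1).factorial : ℝ) * ∑ n ∈ Finset.range q, (β ^ n / (n.factorial : ℝ))
            * upperGamma ((p + a : ℕ) + (n : ℝ)) ((α + β) * c) / (α + β) ^ (n + p + a) := by
  have hsub : Ioi c ⊆ Ici (0 : ℝ) := fun x hx => (hc.trans hx).le
  have hαβ : 0 < α + β := add_pos hα hβ
  have hint : ∀ (k : ℕ) {r : ℝ}, 0 < r →
      IntegrableOn (fun t : ℝ => t ^ k * Real.exp (-(r * t))) (Ioi c) := fun k r hr =>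
    (integrableOn_pow_mul_exp_neg_mul k hr).mono_set (Ioi_subset_Ioi hc.le)
  have hcongr : ∀ x ∈ Ioi c, erlangPDF p α x * (x ^ a * (gammaMeasure q β).real (Iic x))
      = α ^ p / ((p - 1).factorial : ℝ) * (x ^ (p + a - 1) * Real.exp (-(α * x)))
        - ∑ n ∈ Finset.range q, α ^ p / ((p - 1).factorial : ℝ) * (β ^ n / (n.factorial : ℝ))
          * (x ^ (p + a + n - 1) * Real.exp (-((α + β) * x))) := fun x hx => by
    rw [gammaMeasure_real_Iic_eq_erlang hq hβ (hsub hx), erlangPDF, mul_sub, mul_sub, mul_one]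
    congr 1
    · rw [show p + a - 1 = p - 1 + a by omega, pow_add]; ring
    · simp only [Finset.mul_sum]
      refine Finset.sum_congr rfl fun n _ => ?_
      rw [show p + a + n - 1 = p - 1 + a + n by omega, pow_add, pow_add, mul_pow,
        show -((α + β) * x) = -(α * x) + -(β * x) by ring, Real.exp_add]
      ring
  have hnat : ∀ k : ℕ, 0 < k → (((k - 1 : ℕ) : ℝ) + 1) = k := fun k hk => by
    rw [← Nat.cast_succ, Nat.succ_eq_add_one, Nat.sub_add_cancel hk]
  rw [setIntegral_gammaMeasure hp hα measurableSet_Ioi hsub,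
    setIntegral_congr_fun measurableSet_Ioi hcongr, integral_sub ((hint _ hα).const_mul _)
      (integrable_finsetSum _ fun n _ => (hint _ hαβ).const_mul _),
    integral_finsetSum _ fun n _ => (hint _ hαβ).const_mul _, integral_const_mul,
    integral_Ioi_pow_mul_exp_neg_mul _ hα, Finset.mul_sum]
  congr 1
  · rw [hnat _ (by omega), show p + a - 1 + 1 = p + a by omega, pow_add, one_div, inv_pow]
    field_simp
  · refine Finset.sum_congr rfl fun n _ => ?_
    rw [integral_const_mul, integral_Ioi_pow_mul_exp_neg_mul _ hαβ, hnat _ (by omega),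
      show p + a + n - 1 + 1 = n + p + a by omega, Nat.cast_add (p + a) n]
    ring

end MaxMoment

section Asymptotics

lemma measurable_measureReal_Iic (μ : Measure ℝ) [IsFiniteMeasure μ] :
    Measurable fun x => μ.real (Iic x) :=
  Monotone.measurable fun _ _ h => measureReal_mono (Iic_subset_Iic.mpr h)

lemma tendsto_pow_mul_gammaMeasure_real_Iic {k d : ℕ} (hk : 0 < k) (hd : d ≤ k) {c : ℝ}
    (hc : 0 < c) {x : ℝ} (hx : 0 ≤ x) :
    Tendsto (fun δ : ℝ => δ ^ d * (gammaMeasure k (c / δ)).real (Iic x)) atTop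
      (𝓝 (if d = k then (c * x) ^ k / (k.factorial : ℝ) else 0)) := by
  have hinv : Tendsto (fun δ : ℝ => c / δ * x) atTop (𝓝 0) := by
    simpa using (tendsto_const_nhds.div_atTop tendsto_id).mul_const x
  have hexp : Tendsto (fun δ : ℝ => (c * x) ^ k / (k.factorial : ℝ) * Real.exp (-(c / δ * x)))
      atTop (𝓝 ((c * x) ^ k / (k.factorial : ℝ))) := by
    simpa using ((Real.continuous_exp.tendsto _).comp hinv.neg).const_mul
      ((c * x) ^ k / (k.factorial : ℝ))
  have hscale : ∀ δ : ℝ, 0 < δ → δ ^ k * ((c / δ * x) ^ k / (k.factorial : ℝ))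
      = (c * x) ^ k / (k.factorial : ℝ) := fun δ hδ => by
    rw [div_mul_eq_mul_div, div_pow]
    field_simp
  have hmain : Tendsto (fun δ : ℝ => δ ^ k * (gammaMeasure k (c / δ)).real (Iic x)) atTop
      (𝓝 ((c * x) ^ k / (k.factorial : ℝ))) := by
    refine tendsto_of_tendsto_of_tendsto_of_le_of_le' hexp tendsto_const_nhds ?_ ?_
    · filter_upwards [eventually_gt_atTop 0] with δ hδ
      rw [← hscale δ hδ, mul_assoc]
      exact mul_le_mul_of_nonneg_left (le_gammaMeasure_real_Iic hk (div_pos hc hδ) hx)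
        (by positivity)
    · filter_upwards [eventually_gt_atTop 0] with δ hδ
      rw [← hscale δ hδ]
      exact mul_le_mul_of_nonneg_left (gammaMeasure_real_Iic_le hk (div_pos hc hδ) hx)
        (by positivity)
  split_ifs with h
  · rw [h]; exact hmain
  · have hlt : 0 < k - d := by omega
    have hzero : Tendsto (fun δ : ℝ => (δ ^ (k - d))⁻¹) atTop (𝓝 0) :=
      (tendsto_pow_atTop hlt.ne').inv_tendsto_atTop
    have h := hzero.mul hmain
    rw [zero_mul] at h
    refine h.congr' ?_
    filter_upwards [eventually_gt_atTop 0] with δ hδ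
    rw [← Nat.sub_add_cancel hd, Nat.add_sub_cancel, pow_add]
    field_simp

lemma pow_mul_gammaMeasure_real_Iic_le {k d : ℕ} (hk : 0 < k) (hd : d ≤ k) {c : ℝ}
    (hc : 0 < c) {x : ℝ} (hx : 0 ≤ x) {δ : ℝ} (hδ : 1 ≤ δ) :
    δ ^ d * (gammaMeasure k (c / δ)).real (Iic x) ≤ (c * x) ^ k / (k.factorial : ℝ) := by
  have hδ0 : 0 < δ := one_pos.trans_le hδ
  calc δ ^ d * (gammaMeasure k (c / δ)).real (Iic x)
      ≤ δ ^ k * ((c / δ * x) ^ k / (k.factorial : ℝ)) :=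
        mul_le_mul (pow_le_pow_right₀ hδ hd) (gammaMeasure_real_Iic_le hk (div_pos hc hδ0) hx)
          measureReal_nonneg (by positivity)
    _ = (c * x) ^ k / (k.factorial : ℝ) := by
        rw [div_mul_eq_mul_div, div_pow]
        field_simp

/-- High-SNR behaviour of the probability that at least one of two Gamma variables, with rates
vanishing like `1 / δ`, stays below its random threshold. -/
lemma tendsto_pow_mul_one_sub_integral {Ω : Type*} [MeasurableSpace Ω] {P : Measure Ω}
    [IsProbabilityMeasure P] {a b d : ℕ} (ha : 0 < a) (hb : 0 < b) (hda : d ≤ a) (hdb : d ≤ b)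
    {c e : ℝ} (hc : 0 < c) (he : 0 < e) {U V : Ω → ℝ} (hU : Measurable U) (hV : Measurable V)
    (hU0 : ∀ᵐ ω ∂P, 0 ≤ U ω) (hV0 : ∀ᵐ ω ∂P, 0 ≤ V ω)
    (hUa : Integrable (fun ω => U ω ^ a) P) (hVb : Integrable (fun ω => V ω ^ b) P) :
    Tendsto (fun δ : ℝ => δ ^ d * (1 - ∫ ω, (1 - (gammaMeasure a (c / δ)).real (Iic (U ω)))
        * (1 - (gammaMeasure b (e / δ)).real (Iic (V ω))) ∂P)) atTop
      (𝓝 ((if d = a then c ^ a / (a.factorial : ℝ) * ∫ ω, U ω ^ a ∂P else 0)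
        + if d = b then e ^ b / (b.factorial : ℝ) * ∫ ω, V ω ^ b ∂P else 0)) := by
  set F : ℝ → Ω → ℝ := fun δ ω => (gammaMeasure a (c / δ)).real (Iic (U ω)) with hF
  set G : ℝ → Ω → ℝ := fun δ ω => (gammaMeasure b (e / δ)).real (Iic (V ω)) with hG
  have hprob : ∀ {k : ℕ} {r δ : ℝ}, 0 < k → 0 < r → 0 < δ →
      IsProbabilityMeasure (gammaMeasure k (r / δ)) := fun hk hr hδ =>
    isProbabilityMeasure_gammaMeasure_natCast hk (div_pos hr hδ)
  have hFm : ∀ δ : ℝ, 0 < δ → Measurable (F δ) := fun δ hδ => by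
    have := hprob ha hc hδ
    exact (measurable_measureReal_Iic _).comp hU
  have hGm : ∀ δ : ℝ, 0 < δ → Measurable (G δ) := fun δ hδ => by
    have := hprob hb he hδ
    exact (measurable_measureReal_Iic _).comp hV
  have hF0 : ∀ δ ω, 0 ≤ F δ ω := fun δ ω => measureReal_nonneg
  have hG0 : ∀ δ ω, 0 ≤ G δ ω := fun δ ω => measureReal_nonneg
  have hF1 : ∀ δ ω, 0 < δ → F δ ω ≤ 1 := fun δ ω hδ => by
    have := hprob ha hc hδ
    exact measureReal_le_one
  have hG1 : ∀ δ ω, 0 < δ → G δ ω ≤ 1 := fun δ ω hδ => by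
    have := hprob hb he hδ
    exact measureReal_le_one
  have hrewrite : ∀ δ : ℝ, 0 < δ → ∫ ω, δ ^ d * (F δ ω + G δ ω - F δ ω * G δ ω) ∂P
      = δ ^ d * (1 - ∫ ω, (1 - F δ ω) * (1 - G δ ω) ∂P) := fun δ hδ => by
    have hint : Integrable (fun ω => (1 - F δ ω) * (1 - G δ ω)) P := by
      refine (integrable_const (1 : ℝ)).mono'
        (((hFm δ hδ).const_sub 1).mul ((hGm δ hδ).const_sub 1)).aestronglyMeasurable
        (ae_of_all _ fun ω => ?_)
      have h1 := hF0 δ ω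
      have h2 := hG0 δ ω
      have h3 := hF1 δ ω hδ
      have h4 := hG1 δ ω hδ
      rw [Real.norm_of_nonneg (mul_nonneg (by linarith) (by linarith))]
      exact mul_le_one₀ (by linarith) (by linarith) (by linarith)
    have hsub : 1 - ∫ ω, (1 - F δ ω) * (1 - G δ ω) ∂P
        = ∫ ω, (1 - (1 - F δ ω) * (1 - G δ ω)) ∂P := by
      rw [integral_sub (integrable_const _) hint]
      simp
    rw [integral_const_mul, hsub]
    congr 1
    congr 1 with ω
    ring
  have hlim : (∫ ω, ((if d = a then (c * U ω) ^ a / (a.factorial : ℝ) else 0)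
        + if d = b then (e * V ω) ^ b / (b.factorial : ℝ) else 0) ∂P)
      = (if d = a then c ^ a / (a.factorial : ℝ) * ∫ ω, U ω ^ a ∂P else 0)
        + if d = b then e ^ b / (b.factorial : ℝ) * ∫ ω, V ω ^ b ∂P else 0 := by
    have hA : ∀ ω, (if d = a then (c * U ω) ^ a / (a.factorial : ℝ) else 0)
        = (if d = a then c ^ a / (a.factorial : ℝ) else 0) * U ω ^ a := fun ω => by
      split_ifs <;> ring
    have hB : ∀ ω, (if d = b then (e * V ω) ^ b / (b.factorial : ℝ) else 0)
        = (if d = b then e ^ b / (b.factorial : ℝ) else 0) * V ω ^ b := fun ω => by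
      split_ifs <;> ring
    simp_rw [hA, hB]
    rw [integral_add (hUa.const_mul _) (hVb.const_mul _), integral_const_mul, integral_const_mul,
      ite_zero_mul, ite_zero_mul]
  rw [← hlim]
  refine Tendsto.congr' (f₁ := fun δ : ℝ => ∫ ω, δ ^ d * (F δ ω + G δ ω - F δ ω * G δ ω) ∂P)
    ((eventually_gt_atTop 0).mono fun δ hδ => hrewrite δ hδ) ?_
  refine tendsto_integral_filter_of_dominated_convergence
    (fun ω => (c * U ω) ^ a / (a.factorial : ℝ) + (e * V ω) ^ b / (b.factorial : ℝ)) ?_ ?_ ?_ ?_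
  · filter_upwards [eventually_gt_atTop 0] with δ hδ
    exact ((((hFm δ hδ).add (hGm δ hδ)).sub ((hFm δ hδ).mul (hGm δ hδ))).const_mul
      _).aestronglyMeasurable
  · filter_upwards [eventually_ge_atTop 1] with δ hδ
    have hδ0 : 0 < δ := one_pos.trans_le hδ
    filter_upwards [hU0, hV0] with ω hu hv
    have h1 := hF0 δ ω
    have h2 := hG0 δ ω
    have h3 := hF1 δ ω hδ0
    have hu' : δ ^ d * F δ ω ≤ _ := pow_mul_gammaMeasure_real_Iic_le ha hda hc hu hδ
    have hv' : δ ^ d * G δ ω ≤ _ := pow_mul_gammaMeasure_real_Iic_le hb hdb he hv hδ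
    have hδd : 0 ≤ δ ^ d := by positivity
    rw [Real.norm_of_nonneg (mul_nonneg hδd (by nlinarith))]
    have := mul_nonneg hδd (mul_nonneg h1 h2)
    nlinarith
  · simp only [mul_pow]
    exact ((hUa.const_mul _).div_const _).add ((hVb.const_mul _).div_const _)
  · filter_upwards [hU0, hV0] with ω hu hv
    have h1 := tendsto_pow_mul_gammaMeasure_real_Iic ha hda hc hu
    have h2 := tendsto_pow_mul_gammaMeasure_real_Iic hb hdb he hv
    have h3 := tendsto_pow_mul_gammaMeasure_real_Iic hb (Nat.zero_le b) he hv
    rw [if_neg hb.ne] at h3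
    have h := (h1.add h2).sub (h1.mul h3)
    rw [mul_zero, sub_zero] at h
    refine h.congr fun δ => ?_
    simp only [hF, hG]
    ring

end Asymptotics

/-- Scenario II (static nodes, perfect CSI): high-SNR asymptotics of the intercept probability,
`δ^{G_d} P_int(δ) → G_c`, with secrecy diversity order `G_d = min(m_SR N_R, m_RD N_D)` and the
stated secrecy coding gain `G_c`.  Coordinates of the product measure:
`x 0 = γ_SR`, `x 1 = γ_SE₁`, `x 2 = γ_RD`, `x 3 = γ_RE₂`. -/
theorem intercept_probability_high_SNR_asymptotics
    (mSR mRD mSE1 mRE2 NR ND NE1 NE2 : ℕ)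
    (hmSR : 0 < mSR) (hmRD : 0 < mRD) (hmSE1 : 0 < mSE1) (hmRE2 : 0 < mRE2)
    (hNR : 0 < NR) (hND : 0 < ND) (hNE1 : 0 < NE1) (hNE2 : 0 < NE2)
    (δSE1 δRE2 : ℝ) (hδSE1 : 0 < δSE1) (hδRE2 : 0 < δRE2)
    (γth : ℝ) (hγth : 0 < γth)
    (Pint : ℝ → ℝ)
    (hPint : Pint = fun δ =>
      1 - ((Measure.pi (fun i : Fin 4 =>
              gammaMeasure
                (![((mSR * NR : ℕ) : ℝ), ((mSE1 * NE1 : ℕ) : ℝ),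
                   ((mRD * ND : ℕ) : ℝ), ((mRE2 * NE2 : ℕ) : ℝ)] i)
                (![(mSR : ℝ) / δ, (mSE1 : ℝ) / δSE1, (mRD : ℝ) / δ,
                   (mRE2 : ℝ) / δRE2] i)))
            {x | x 0 > γth ∧ x 0 > x 1 ∧ x 0 > x 3 ∧ x 2 > x 3}).toReal)
    (Gd : ℕ) (hGd : Gd = min (mSR * NR) (mRD * ND))
    (R T1 T2 T3 FSE1 FRE2 GSE GRE Gc : ℝ)
    (hR : R = ((mRD : ℝ) * δRE2 / mRE2) ^ (mRD * ND)
        * (Nat.factorial (mRE2 * NE2 + mRD * ND - 1) : ℝ)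
        / ((Nat.factorial (mRE2 * NE2 - 1) : ℝ) * (Nat.factorial (mRD * ND) : ℝ)))
    (hT1 : T1 = (((mSR : ℝ) * γth) ^ (mSR * NR) / (Nat.factorial (mSR * NR) : ℝ))
        * (lowerGamma ((mRE2 * NE2 : ℕ) : ℝ) ((mRE2 / δRE2) * γth)
            / (Nat.factorial (mRE2 * NE2 - 1) : ℝ))
        * (lowerGamma ((mSE1 * NE1 : ℕ) : ℝ) ((mSE1 / δSE1) * γth)
            / (Nat.factorial (mSE1 * NE1 - 1) : ℝ)))
    (hFSE1 : FSE1 = (δSE1 / mSE1) ^ (mSR * NR)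
        * upperGamma ((mSE1 * NE1 + mSR * NR : ℕ) : ℝ) ((mSE1 / δSE1) * γth)
        / (Nat.factorial (mSE1 * NE1 - 1) : ℝ))
    (hFRE2 : FRE2 = (δRE2 / mRE2) ^ (mSR * NR)
        * upperGamma ((mRE2 * NE2 + mSR * NR : ℕ) : ℝ) ((mRE2 / δRE2) * γth)
        / (Nat.factorial (mRE2 * NE2 - 1) : ℝ))
    (hT2 : T2 = (mSR : ℝ) ^ (mSR * NR) * (FSE1 + FRE2) / (Nat.factorial (mSR * NR) : ℝ))
    (hGSE : GSE = (((mSE1 : ℝ) / δSE1) ^ (mSE1 * NE1)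
          / (Nat.factorial (mSE1 * NE1 - 1) : ℝ))
        * ∑ n ∈ Finset.range (mRE2 * NE2),
            (((mRE2 : ℝ) / δRE2) ^ n / (Nat.factorial n : ℝ))
              * upperGamma ((mSE1 * NE1 + mSR * NR : ℕ) + (n : ℝ))
                  (((mSE1 : ℝ) / δSE1 + (mRE2 : ℝ) / δRE2) * γth)
              / ((mSE1 : ℝ) / δSE1 + (mRE2 : ℝ) / δRE2)
                  ^ (n + mSE1 * NE1 + mSR * NR))
    (hGRE : GRE = (((mRE2 : ℝ) / δRE2) ^ (mRE2 * NE2)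
          / (Nat.factorial (mRE2 * NE2 - 1) : ℝ))
        * ∑ n ∈ Finset.range (mSE1 * NE1),
            (((mSE1 : ℝ) / δSE1) ^ n / (Nat.factorial n : ℝ))
              * upperGamma ((mRE2 * NE2 + mSR * NR : ℕ) + (n : ℝ))
                  (((mRE2 : ℝ) / δRE2 + (mSE1 : ℝ) / δSE1) * γth)
              / ((mRE2 : ℝ) / δRE2 + (mSE1 : ℝ) / δSE1)
                  ^ (n + mRE2 * NE2 + mSR * NR))
    (hT3 : T3 = (mSR : ℝ) ^ (mSR * NR) * (GSE + GRE) / (Nat.factorial (mSR * NR) : ℝ))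
    (hGc : Gc = if mRD * ND < mSR * NR then R
        else if mSR * NR < mRD * ND then T1 + T2 - T3
        else R + T1 + T2 - T3) :
    Tendsto (fun δ : ℝ => δ ^ Gd * Pint δ) atTop (𝓝 Gc) := by
  have hp : 0 < mSE1 * NE1 := Nat.mul_pos hmSE1 hNE1
  have hq : 0 < mRE2 * NE2 := Nat.mul_pos hmRE2 hNE2
  have ha : 0 < mSR * NR := Nat.mul_pos hmSR hNR
  have hb : 0 < mRD * ND := Nat.mul_pos hmRD hND
  have hSR : (0 : ℝ) < mSR := Nat.cast_pos.mpr hmSR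
  have hRD : (0 : ℝ) < mRD := Nat.cast_pos.mpr hmRD
  have hRE2 : (0 : ℝ) < mRE2 := Nat.cast_pos.mpr hmRE2
  have hα : 0 < (mSE1 : ℝ) / δSE1 := div_pos (Nat.cast_pos.mpr hmSE1) hδSE1
  have hβ : 0 < (mRE2 : ℝ) / δRE2 := div_pos hRE2 hδRE2
  have hαinv : δSE1 / (mSE1 : ℝ) = 1 / ((mSE1 : ℝ) / δSE1) := by rw [one_div_div]
  have hβinv : δRE2 / (mRE2 : ℝ) = 1 / ((mRE2 : ℝ) / δRE2) := by rw [one_div_div]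
  have hRE2δ : (mRD : ℝ) * δRE2 / mRE2 = mRD / ((mRE2 : ℝ) / δRE2) := by field_simp
  rw [hαinv] at hFSE1
  rw [hβinv] at hFRE2
  rw [hRE2δ] at hR
  set p := mSE1 * NE1
  set q := mRE2 * NE2
  set a := mSR * NR
  set b := mRD * ND
  set α : ℝ := (mSE1 : ℝ) / δSE1
  set β : ℝ := (mRE2 : ℝ) / δRE2
  clear_value α β
  have := isProbabilityMeasure_gammaMeasure_natCast hp hα
  have := isProbabilityMeasure_gammaMeasure_natCast hq hβ
  have hpow := integrable_pow_gammaMeasure hp hα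
  have hqow := integrable_pow_gammaMeasure hq hβ
  have hp0 := ae_pos_gammaMeasure p α
  have hq0 := ae_pos_gammaMeasure q β
  have hlim := tendsto_pow_mul_one_sub_integral
    (P := (gammaMeasure p α).prod (gammaMeasure q β))
    (U := fun y => max γth (max y.1 y.2)) (V := fun y => y.2) ha hb
    (hGd.trans_le (min_le_left a b)) (hGd.trans_le (min_le_right a b)) hSR hRD
    (by fun_prop) (by fun_prop) (ae_of_all _ fun y => hγth.le.trans (le_max_left _ _))
    ((Measure.quasiMeasurePreserving_snd.ae hq0).mono fun y hy => hy.le)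
    (integrable_max_pow (hpow a) (hqow a) hp0 hq0 hγth) ((hqow b).comp_snd _)
  have hU : (mSR : ℝ) ^ a / (a.factorial : ℝ) * ∫ y, max γth (max y.1 y.2) ^ a
      ∂(gammaMeasure p α).prod (gammaMeasure q β) = T1 + T2 - T3 := by
    rw [integral_max_pow (hpow a) (hqow a),
      setIntegral_pow_mul_gammaMeasure_real_Iic hp hq hα hβ a hγth,
      setIntegral_pow_mul_gammaMeasure_real_Iic hq hp hβ hα a hγth,
      gammaMeasure_real_Iic_eq_lowerGamma hp hα hγth.le,
      gammaMeasure_real_Iic_eq_lowerGamma hq hβ hγth.le, ← hFSE1, ← hFRE2, ← hGSE, ← hGRE,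
      hT1, hT2, hT3, mul_pow]
    ring
  have hV : (mRD : ℝ) ^ b / (b.factorial : ℝ) * ∫ y, y.2 ^ b
      ∂(gammaMeasure p α).prod (gammaMeasure q β) = R := by
    rw [integral_fun_snd (fun z : ℝ => z ^ b), probReal_univ, one_smul,
      integral_pow_gammaMeasure hq hβ, hR, div_pow]
    field_simp
  rw [hU, hV] at hlim
  have hval : ((if Gd = a then T1 + T2 - T3 else 0) + if Gd = b then R else 0) = Gc := by
    rw [hGc, hGd]
    rcases lt_trichotomy a b with h | h | h
    · rw [min_eq_left h.le, if_pos rfl, if_neg h.ne, if_neg h.not_gt, if_pos h, add_zero]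
    · rw [h, min_self, if_pos rfl, if_pos rfl, if_neg (lt_irrefl _), if_neg (lt_irrefl _)]
      ring
    · rw [min_eq_right h.le, if_neg h.ne, if_pos rfl, if_pos h, zero_add]
  rw [hval] at hlim
  refine hlim.congr' ?_
  filter_upwards [eventually_gt_atTop 0] with δ hδ
  have hprob : ∀ i : Fin 4, IsProbabilityMeasure (gammaMeasure
      (![(a : ℝ), (p : ℝ), (b : ℝ), (q : ℝ)] i) (![(mSR : ℝ) / δ, α, (mRD : ℝ) / δ, β] i)) := by
    have := isProbabilityMeasure_gammaMeasure_natCast ha (div_pos hSR hδ)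
    have := isProbabilityMeasure_gammaMeasure_natCast hb (div_pos hRD hδ)
    intro i
    fin_cases i <;> assumption
  rw [hPint]
  exact congrArg (fun s : ℝ => δ ^ Gd * (1 - s)) (pi_real_secure_eq_integral
    (fun i : Fin 4 => gammaMeasure (![(a : ℝ), (p : ℝ), (b : ℝ), (q : ℝ)] i)
      (![(mSR : ℝ) / δ, α, (mRD : ℝ) / δ, β] i)) γth).symm
end
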